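/- Let σ > 0, let ω_1, …, ω_N be vectors in ℝ³ not all zero, and let H = (1/σ²) ∑_{k=1}^N (‖ω_k‖² I₃ − ω_k ω_kᵀ), which equals (1/σ²) ∑_k ⌊ω_k⌋ᵀ ⌊ω_k⌋ where ⌊ω⌋ is the skew-symmetric cross-product matrix of ω. If H is invertible, then Tr(H⁻¹) ≥ 9 σ² / (2 ∑_{k=1}^N ‖ω_k‖²) = 4.5 σ² / ∑_{k=1}^N ‖ω_k‖². -/

import Mathlib

/-- The skew-symmetric cross-product matrix `⌊ω⌋` of `ω ∈ ℝ³`. -/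
noncomputable def crossMat (ω : EuclideanSpace ℝ (Fin 3)) : Matrix (Fin 3) (Fin 3) ℝ :=
  !![0, -ω 2, ω 1;
     ω 2, 0, -ω 0;
     -ω 1, ω 0, 0]

/-- The outer product `u vᵀ` of two vectors of `ℝ³`, as a `3 × 3` matrix. -/
noncomputable def outerProd (u v : EuclideanSpace ℝ (Fin 3)) : Matrix (Fin 3) (Fin 3) ℝ :=
  Matrix.vecMulVec u v

open Matrix in
/-- Cauchy–Schwarz for the trace of a positive definite matrix and of its inverse. -/
theorem Matrix.PosDef.card_sq_div_trace_le_trace_inv {n : Type*} [Fintype n] [DecidableEq n]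
    {A : Matrix n n ℝ} (hA : A.PosDef) (htr : A.trace ≠ 0) :
    (Fintype.card n : ℝ) ^ 2 / A.trace ≤ A⁻¹.trace := by
  have hunit : IsUnit A.det := A.isUnit_iff_isUnit_det.mp hA.isUnit
  set t : ℝ := Fintype.card n / A.trace with ht
  have hnonneg := (hA.inv.posSemidef.mul_mul_conjTranspose_same (1 - t • A)).trace_nonneg
  have hexpand : (1 - t • A) * A⁻¹ * (1 - t • A)ᴴ = A⁻¹ - (2 * t) • 1 + t ^ 2 • A := by
    have hAh : Aᴴ = A := hA.isHermitian
    rw [conjTranspose_sub, conjTranspose_smul, hAh, conjTranspose_one, star_trivial, sub_mul,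
      one_mul, smul_mul_assoc, mul_nonsing_inv A hunit, mul_sub, mul_one, sub_mul,
      mul_smul_comm, nonsing_inv_mul A hunit, smul_mul_assoc, one_mul]
    module
  rw [hexpand, trace_add, trace_sub, trace_smul, trace_smul, trace_one, smul_eq_mul,
    smul_eq_mul] at hnonneg
  have hval : 2 * t * Fintype.card n - t ^ 2 * A.trace = (Fintype.card n : ℝ) ^ 2 / A.trace := by
    rw [ht]
    field_simp
    ring
  linarith

theorem norm_sq_smul_one_sub_outerProd (v : EuclideanSpace ℝ (Fin 3)) :
    ‖v‖ ^ 2 • (1 : Matrix (Fin 3) (Fin 3) ℝ) - outerProd v v =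
      (crossMat v).transpose * crossMat v := by
  rw [EuclideanSpace.real_norm_sq_eq, Fin.sum_univ_three]
  ext i j
  fin_cases i <;> fin_cases j <;>
    simp [outerProd, crossMat, Matrix.vecMulVec_apply, Matrix.mul_apply, Fin.sum_univ_three] <;>
    ring

theorem trace_norm_sq_smul_one_sub_outerProd (v : EuclideanSpace ℝ (Fin 3)) :
    (‖v‖ ^ 2 • (1 : Matrix (Fin 3) (Fin 3) ℝ) - outerProd v v).trace = 2 * ‖v‖ ^ 2 := by
  rw [EuclideanSpace.real_norm_sq_eq, Fin.sum_univ_three]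
  simp [outerProd, dotProduct, Fin.sum_univ_three]
  ring

/-- for `H = (1/σ²) ∑ₖ (‖ωₖ‖² I₃ − ωₖ ωₖᵀ) = (1/σ²) ∑ₖ ⌊ωₖ⌋ᵀ ⌊ωₖ⌋`,
if `H` is invertible then `Tr(H⁻¹) ≥ 9 σ² / (2 ∑ₖ ‖ωₖ‖²) = 4.5 σ² / ∑ₖ ‖ωₖ‖²`. -/
theorem stmt16 (σ : ℝ) (hσ : 0 < σ) (N : ℕ)
    (ω : Fin N → EuclideanSpace ℝ (Fin 3)) (hω : ∃ k, ω k ≠ 0)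
    (H : Matrix (Fin 3) (Fin 3) ℝ)
    (hH : H = (σ ^ 2)⁻¹ •
      ∑ k, (‖ω k‖ ^ 2 • (1 : Matrix (Fin 3) (Fin 3) ℝ) - outerProd (ω k) (ω k)))
    (hHunit : IsUnit H) :
    H = (σ ^ 2)⁻¹ • ∑ k, (crossMat (ω k)).transpose * crossMat (ω k) ∧
    H⁻¹.trace ≥ 9 * σ ^ 2 / (2 * ∑ k, ‖ω k‖ ^ 2) ∧
    9 * σ ^ 2 / (2 * ∑ k, ‖ω k‖ ^ 2) = 4.5 * σ ^ 2 / ∑ k, ‖ω k‖ ^ 2 := by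
  have hcross : H = (σ ^ 2)⁻¹ • ∑ k, (crossMat (ω k)).transpose * crossMat (ω k) := by
    simpa only [norm_sq_smul_one_sub_outerProd] using hH
  have hS : 0 < ∑ k, ‖ω k‖ ^ 2 := by
    obtain ⟨k, hk⟩ := hω
    exact Finset.sum_pos' (fun i _ => sq_nonneg _)
      ⟨k, Finset.mem_univ k, pow_pos (norm_pos_iff.mpr hk) 2⟩
  have hpsd : H.PosSemidef := by
    rw [hcross]
    refine (Matrix.posSemidef_sum _ fun k _ => ?_).smul (by positivity)
    simpa using Matrix.posSemidef_conjTranspose_mul_self (crossMat (ω k))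
  have htrace : H.trace = 2 * (∑ k, ‖ω k‖ ^ 2) / σ ^ 2 := by
    rw [hH, Matrix.trace_smul, Matrix.trace_sum]
    simp only [trace_norm_sq_smul_one_sub_outerProd]
    rw [← Finset.mul_sum, smul_eq_mul, div_eq_inv_mul]
  refine ⟨hcross, ?_, ?_⟩
  · have hbound := (hpsd.posDef_iff_isUnit.mpr hHunit).card_sq_div_trace_le_trace_inv
      (by rw [htrace]; positivity)
    rw [htrace, Fintype.card_fin] at hbound
    refine le_of_eq_of_le ?_ hbound
    field_simp
    norm_num
  · field_simp
    norm_num
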